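/- Let q = p^k be an odd prime power and n = n'·q^i with i ≥ 0, gcd(n', q) = 1 and n' ∤ q − 1, and suppose n ≥ 5. Let e > 2 be the multiplicative order of q modulo n'. Take l = q^n − 1, let g' be the product of all distinct monic irreducible factors of x^{n'} − 1 over F_q of degree strictly less than e, and let g = g'/(x − 1). Let L be the largest divisor of x^n − 1 not divisible by x − 1, let s be the number of distinct monic irreducible factors of L not dividing g, written g_1, ..., g_s, and let t be the number of distinct monic irreducible factors of x^n − 1 not dividing g', written g'_1, ..., g'_t. Then S := 1 − Σ_{j=1}^s 1/q^{deg(g_j)} − Σ_{j=1}^t 1/q^{deg(g'_j)} > 0 and M := (s + t − 1)/S + 2 satisfies M < 2n'. -/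

import Mathlib

open Polynomial

noncomputable section PrimitiveNormalSubtrace

/-- `q` is an odd prime power. -/
def IsOddPrimePow (q : ℕ) : Prop := ∃ p k : ℕ, p.Prime ∧ Odd p ∧ 0 < k ∧ q = p ^ k

/-- The trace `Tr_{q^n/q}(ε) = ∑_{i<n} ε^{q^i}`. -/
def traceQ (q n : ℕ) {F : Type*} [Field F] (ε : F) : F := ∑ i ∈ Finset.range n, ε ^ q ^ i

/-- The subtrace `STr_{q^n/q}(ε) = ∑_{0 ≤ i < j ≤ n-1} ε^{q^i + q^j}`. -/
def subtraceQ (q n : ℕ) {F : Type*} [Field F] (ε : F) : F :=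
  ∑ i ∈ Finset.range n, ∑ j ∈ Finset.Ico (i + 1) n, ε ^ (q ^ i + q ^ j)

/-- `ε` is `l`-free: if `ε = δ^j` with `j ∣ l` then `j = 1`. -/
def LFree (l : ℕ) {F : Type*} [Field F] (ε : F) : Prop :=
  ∀ (δ : F) (j : ℕ), j ∣ l → ε = δ ^ j → j = 1

/-- The `F_q[x]`-module action `h ∘ ε = ∑ a_i ε^{q^i}`. -/
def polyAct (q : ℕ) {Fq F : Type*} [Field Fq] [Field F] [Algebra Fq F]
    (h : Polynomial Fq) (ε : F) : F :=
  ∑ i ∈ Finset.range (h.natDegree + 1), algebraMap Fq F (h.coeff i) * ε ^ q ^ i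

/-- `ε` is `g`-free: if `ε = h ∘ δ` with `h` a monic divisor of `g` then `h = 1`. -/
def GFree (q : ℕ) {Fq F : Type*} [Field Fq] [Field F] [Algebra Fq F]
    (g : Polynomial Fq) (ε : F) : Prop :=
  ∀ (h : Polynomial Fq) (δ : F), h.Monic → h ∣ g → ε = polyAct q h δ → h = 1

/-- `f` is an irreducible polynomial or a nonzero constant. -/
def IrredOrConst {F : Type*} [Field F] (f : Polynomial F) : Prop :=
  f ≠ 0 ∧ (Irreducible f ∨ f.natDegree = 0)

/-- `f1/f2` belongs to `R_{q,n}(m)`: both numerator and denominator are irreducible or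
nonzero constants, coprime, and the degrees sum to `m`. -/
def InRat {F : Type*} [Field F] (m : ℕ) (f1 f2 : Polynomial F) : Prop :=
  IrredOrConst f1 ∧ IrredOrConst f2 ∧ IsCoprime f1 f2 ∧ f1.natDegree + f2.natDegree = m

/-- `ε` is a primitive element of the field with `q^n` elements. -/
def IsPrimitiveElem (q n : ℕ) {F : Type*} [Field F] (ε : F) : Prop := orderOf ε = q ^ n - 1

/-- `ε` is normal over `F_q`: its conjugates `ε, ε^q, …, ε^{q^{n-1}}` form an `F_q`-basis. -/
def IsNormalElem (q n : ℕ) (Fq : Type*) {F : Type*} [Field Fq] [Field F] [Algebra Fq F]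
    (ε : F) : Prop :=
  LinearIndependent Fq (fun i : Fin n => ε ^ q ^ (i : ℕ)) ∧
    Submodule.span Fq (Set.range fun i : Fin n => ε ^ q ^ (i : ℕ)) = ⊤

/-- The counting function `C_{f,a,b}(l1,l2,g1,g2)`. -/
def Ccount (q n : ℕ) {Fq F : Type*} [Field Fq] [Field F] [Algebra Fq F]
    (f1 f2 : Polynomial F) (a b : Fq) (l1 l2 : ℕ) (g1 g2 : Polynomial Fq) : ℕ :=
  Nat.card {ε : F // ε ≠ 0 ∧ f1.eval ε ≠ 0 ∧ f2.eval ε ≠ 0 ∧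
    LFree l1 ε ∧ GFree q g1 ε ∧
    LFree l2 (f1.eval ε / f2.eval ε) ∧ GFree q g2 (f1.eval ε / f2.eval ε) ∧
    traceQ q n ε = algebraMap Fq F b ∧ traceQ q n (ε ^ 2) = algebraMap Fq F (-a)}

/-- `(q,n) ∈ D_m`. -/
def memD (q n m : ℕ) : Prop :=
  ∀ (Fq F : Type) [Field Fq] [Field F] [Fintype Fq] [Fintype F] [Algebra Fq F],
    Fintype.card Fq = q → Fintype.card F = q ^ n →
    ∀ f1 f2 : Polynomial F, InRat m f1 f2 →
    ∀ a b : Fq, a ≠ 0 → b ≠ 0 → a = b ^ 2 →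
    ∃ ε : F, ε ≠ 0 ∧ f1.eval ε ≠ 0 ∧ f2.eval ε ≠ 0 ∧
      IsPrimitiveElem q n ε ∧ IsNormalElem q n Fq ε ∧
      IsPrimitiveElem q n (f1.eval ε / f2.eval ε) ∧
      IsNormalElem q n Fq (f1.eval ε / f2.eval ε) ∧
      traceQ q n ε = algebraMap Fq F b ∧ traceQ q n (ε ^ 2) = algebraMap Fq F (-a)

/-- `W(l) = 2^{ω(l)}`, the number of squarefree divisors of a positive integer. -/
def Wnat (l : ℕ) : ℕ := 2 ^ l.primeFactors.card

/-- `ω(g)`: the number of distinct monic irreducible factors of a polynomial. -/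
def omegaPoly {Fq : Type*} [Field Fq] (g : Polynomial Fq) : ℕ :=
  {p : Polynomial Fq | p.Monic ∧ Irreducible p ∧ p ∣ g}.ncard

/-- `W(g) = 2^{ω(g)}`, the number of (monic) squarefree factors of a polynomial. -/
def Wpoly {Fq : Type*} [Field Fq] (g : Polynomial Fq) : ℕ := 2 ^ omegaPoly g

/-- `θ(l) = φ(l)/l`. -/
def thetaN (l : ℕ) : ℝ := (Nat.totient l : ℝ) / l

/-- `Φ_q(g)`: the order of the unit group of `F_q[x]/(g)`. -/
def PhiQ {Fq : Type*} [Field Fq] (g : Polynomial Fq) : ℕ :=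
  Nat.card (Polynomial Fq ⧸ Ideal.span ({g} : Set (Polynomial Fq)))ˣ

/-- `Θ(g) = Φ_q(g)/q^{deg g}`. -/
def ThetaP (q : ℕ) {Fq : Type*} [Field Fq] (g : Polynomial Fq) : ℝ :=
  (PhiQ g : ℝ) / (q : ℝ) ^ g.natDegree

/-- `L` is the largest divisor of `Gg` that is not divisible by `x - 1`. -/
def IsMaxDivisorPrimeToXsub1 {Fq : Type*} [Field Fq] (Gg L : Polynomial Fq) : Prop :=
  L.Monic ∧ L ∣ Gg ∧ ¬ (X - 1 : Polynomial Fq) ∣ L ∧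
    ∀ h : Polynomial Fq, h ∣ Gg → ¬ (X - 1 : Polynomial Fq) ∣ h → h ∣ L

end PrimitiveNormalSubtrace

theorem aux_pow_eq {K : Type} [Field K] [Fintype K] (m i : ℕ) :
    (X ^ (m * Fintype.card K ^ i) - 1 : Polynomial K) = (X ^ m - 1) ^ (Fintype.card K ^ i) := by
  induction i with
  | zero => simp
  | succ j ih =>
    rw [pow_succ, pow_mul (X ^ m - 1 : Polynomial K), ← ih, ← FiniteField.expand_card]
    simp only [map_sub, map_pow, expand_X, map_one]
    rw [← pow_mul]
    congr 2
    ring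

theorem aux_card {K : Type} [Field K] (m e : ℕ) (hm : 0 < m) (he : 2 < e)
    (T : Finset (Polynomial K))
    (hT : ∀ f ∈ T, f.Monic ∧ Irreducible f ∧ f ∣ (X ^ m - 1 : Polynomial K) ∧ e ≤ f.natDegree) :
    e * T.card + 1 ≤ m := by
  classical
  have hX1 : (X - 1 : Polynomial K) = X - C 1 := by simp
  have hXd : (X - 1 : Polynomial K).natDegree = 1 := by rw [hX1]; exact natDegree_X_sub_C 1
  have hXm : (X - 1 : Polynomial K).Monic := by rw [hX1]; exact monic_X_sub_C 1
  have hXi : Irreducible (X - 1 : Polynomial K) := by rw [hX1]; exact irreducible_X_sub_C 1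
  have hnot : (X - 1 : Polynomial K) ∉ T := fun h => by
    have := (hT _ h).2.2.2
    omega
  have hall : ∀ f ∈ insert (X - 1 : Polynomial K) T,
      f.Monic ∧ Irreducible f ∧ f ∣ (X ^ m - 1 : Polynomial K) := by
    intro f hf
    rcases Finset.mem_insert.1 hf with rfl | hf
    · exact ⟨hXm, hXi, sub_one_dvd_pow_sub_one _ _⟩
    · exact ⟨(hT f hf).1, (hT f hf).2.1, (hT f hf).2.2.1⟩
  have hdvd : (∏ f ∈ insert (X - 1 : Polynomial K) T, f) ∣ (X ^ m - 1 : Polynomial K) := by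
    apply Finset.prod_dvd_of_coprime
    · intro a ha b hb hab
      obtain ⟨ma, ia, -⟩ := hall a ha
      obtain ⟨mb, ib, -⟩ := hall b hb
      refine (ia.coprime_iff_not_dvd.2 fun h => hab ?_)
      exact eq_of_monic_of_associated ma mb (ia.associated_of_dvd ib h)
    · intro a ha
      exact (hall a ha).2.2
  have hne : (X ^ m - 1 : Polynomial K) ≠ 0 := by
    have := X_pow_sub_C_ne_zero hm (1 : K)
    simpa using this
  have hdeg := natDegree_le_of_dvd hdvd hne
  have hd : (X ^ m - 1 : Polynomial K).natDegree = m := by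
    have := natDegree_X_pow_sub_C (n := m) (r := (1 : K))
    simpa using this
  rw [natDegree_prod_of_monic _ _ (fun f hf => (hall f hf).1), Finset.sum_insert hnot, hd, hXd]
    at hdeg
  have : T.card * e ≤ ∑ f ∈ T, f.natDegree := by
    have := Finset.card_nsmul_le_sum T natDegree e (fun f hf => (hT f hf).2.2.2)
    simpa using this
  rw [mul_comm]
  omega

theorem sieve_M_lt_two_n' (p k : ℕ) (hp : p.Prime) (hodd : Odd p) (hk : 0 < k)
    (q : ℕ) (hq : q = p ^ k)
    (n n' i : ℕ) (hn : n = n' * q ^ i) (hcop : Nat.Coprime n' q)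
    (hndvd : ¬ n' ∣ q - 1) (hn5 : 5 ≤ n)
    (e : ℕ) (he : e = orderOf ((q : ZMod n'))) (he2 : 2 < e)
    (Fq : Type) [Field Fq] [Fintype Fq] (hcard : Fintype.card Fq = q)
    (FF : Finset (Polynomial Fq))
    (hFF : ∀ p' : Polynomial Fq, p' ∈ FF ↔ p'.Monic ∧ Irreducible p' ∧
      p' ∣ (X ^ n' - 1 : Polynomial Fq) ∧ p'.natDegree < e)
    (g' g : Polynomial Fq) (hg' : g' = ∏ p' ∈ FF, p')
    (hg : g * (X - 1 : Polynomial Fq) = g')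
    (L : Polynomial Fq) (hL : IsMaxDivisorPrimeToXsub1 (X ^ n - 1) L)
    (GS TS : Finset (Polynomial Fq))
    (hGS : ∀ p' : Polynomial Fq, p' ∈ GS ↔ p'.Monic ∧ Irreducible p' ∧ p' ∣ L ∧ ¬ p' ∣ g)
    (hTS : ∀ p' : Polynomial Fq, p' ∈ TS ↔ p'.Monic ∧ Irreducible p' ∧
      p' ∣ (X ^ n - 1 : Polynomial Fq) ∧ ¬ p' ∣ g')
    (S : ℝ)
    (hS : S = 1 - (∑ gj ∈ GS, (1 : ℝ) / (q : ℝ) ^ gj.natDegree) -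
      ∑ gj ∈ TS, (1 : ℝ) / (q : ℝ) ^ gj.natDegree) :
    0 < S ∧ ((GS.card : ℝ) + (TS.card : ℝ) - 1) / S + 2 < 2 * (n' : ℝ) := by
  have hq1 : 1 < q := by rw [← hcard]; exact Fintype.one_lt_card
  have hn'0 : 0 < n' := by
    rcases Nat.eq_zero_or_pos n' with h | h
    · subst h; simp at hn; omega
    · exact h
  have hQ : n' + 1 ≤ q ^ e := by
    have h1 : ((q : ZMod n')) ^ e = 1 := by rw [he]; exact pow_orderOf_eq_one _
    have h2 : ((1 : ℕ) : ZMod n') = ((q ^ e : ℕ) : ZMod n') := by push_cast; exact h1.symm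
    have h3 := (Nat.modEq_iff_dvd' (Nat.one_le_pow _ _ (by omega))).1
      ((ZMod.natCast_eq_natCast_iff _ _ _).1 h2)
    have h4 : 1 < q ^ e := Nat.one_lt_pow (by omega) hq1
    have := Nat.le_of_dvd (by omega) h3
    omega
  have hfac : ∀ f : Polynomial Fq, Irreducible f → f ∣ (X ^ n - 1 : Polynomial Fq) →
      f ∣ (X ^ n' - 1 : Polynomial Fq) := by
    intro f hf hd
    rw [hn, ← hcard, aux_pow_eq] at hd
    exact hf.prime.dvd_of_dvd_pow hd
  have hX1 : (X - 1 : Polynomial Fq) = X - C 1 := by simp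
  have hXi : Irreducible (X - 1 : Polynomial Fq) := by rw [hX1]; exact irreducible_X_sub_C 1
  have hT : ∀ f ∈ TS, f.Monic ∧ Irreducible f ∧ f ∣ (X ^ n' - 1 : Polynomial Fq) ∧
      e ≤ f.natDegree := by
    intro f hf
    obtain ⟨h1, h2, h3, h4⟩ := (hTS f).1 hf
    refine ⟨h1, h2, hfac f h2 h3, ?_⟩
    by_contra hlt
    apply h4
    rw [hg']
    exact Finset.dvd_prod_of_mem _ ((hFF f).2 ⟨h1, h2, hfac f h2 h3, by omega⟩)
  have hG : ∀ f ∈ GS, f.Monic ∧ Irreducible f ∧ f ∣ (X ^ n' - 1 : Polynomial Fq) ∧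
      e ≤ f.natDegree := by
    intro f hf
    obtain ⟨h1, h2, h3, h4⟩ := (hGS f).1 hf
    have h5 := hfac f h2 (h3.trans hL.2.1)
    refine ⟨h1, h2, h5, ?_⟩
    by_contra hlt
    have h6 : f ∣ g * (X - 1 : Polynomial Fq) := by
      rw [hg, hg']
      exact Finset.dvd_prod_of_mem _ ((hFF f).2 ⟨h1, h2, h5, by omega⟩)
    rcases h2.prime.dvd_or_dvd h6 with h7 | h7
    · exact h4 h7
    · exact hL.2.2.1 (((h2.associated_of_dvd hXi h7).symm.dvd).trans h3)
  have cG := aux_card n' e hn'0 he2 GS hG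
  have cT := aux_card n' e hn'0 he2 TS hT
  have cG3 : 3 * GS.card + 1 ≤ n' := by nlinarith
  have cT3 : 3 * TS.card + 1 ≤ n' := by nlinarith
  have hqR : (1 : ℝ) ≤ q := by exact_mod_cast hq1.le
  have hsum : ∀ A : Finset (Polynomial Fq), (∀ f ∈ A, e ≤ f.natDegree) →
      (∑ gj ∈ A, (1 : ℝ) / (q : ℝ) ^ gj.natDegree) ≤ A.card * (1 / (q : ℝ) ^ e) := by
    intro A hA
    rw [← nsmul_eq_mul]
    refine Finset.sum_le_card_nsmul _ _ _ fun f hf => ?_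
    exact one_div_le_one_div_of_le (by positivity) (pow_le_pow_right₀ hqR (hA f hf))
  have sG := hsum GS fun f hf => (hG f hf).2.2.2
  have sT := hsum TS fun f hf => (hT f hf).2.2.2
  have hQR : (n' : ℝ) + 1 ≤ (q : ℝ) ^ e := by exact_mod_cast hQ
  have cGR : 3 * (GS.card : ℝ) + 1 ≤ n' := by exact_mod_cast cG3
  have cTR : 3 * (TS.card : ℝ) + 1 ≤ n' := by exact_mod_cast cT3
  have hnR : (1 : ℝ) ≤ n' := by exact_mod_cast hn'0
  have hG0 : (0 : ℝ) ≤ GS.card := by positivity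
  have hT0 : (0 : ℝ) ≤ TS.card := by positivity
  generalize (GS.card : ℝ) = a at *
  generalize (TS.card : ℝ) = b at *
  generalize (n' : ℝ) = N at *
  have hu : 0 < 1 / (q : ℝ) ^ e := by positivity
  have huN : N * (1 / (q : ℝ) ^ e) < 1 := by
    rw [mul_one_div, div_lt_one (by positivity)]; linarith
  generalize 1 / (q : ℝ) ^ e = u at *
  have hS1 : 1 - (a + b) * u ≤ S := by rw [hS]; linarith
  have hSpos : 0 < S := by nlinarith
  refine ⟨hSpos, ?_⟩
  have key : (a + b - 1) / S < 2 * N - 2 := by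
    rw [div_lt_iff₀ hSpos]
    have h1 : (2 * N - 2) * (1 - (a + b) * u) ≤ (2 * N - 2) * S :=
      mul_le_mul_of_nonneg_left hS1 (by linarith)
    have h2 : (a + b) * ((N - 1) * u) ≤ (a + b) * 1 :=
      mul_le_mul_of_nonneg_left (by nlinarith) (by linarith)
    nlinarith
  linarith
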